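/- arXiv:1703.09305 — 7 statements merged into one kernel-verified Lean document; each statement's English description precedes it below -/
import Mathlib

section
/- Let 𝒥 be a set of p-value buckets and let ε ∈ (0, 1/2). The following three statements are equivalent: (1) there exists a sequential procedure (τ, I) for 𝒥 satisfying P_p(p ∉ I) ≤ ε for all p ∈ [0,1] and E_p[τ] < ∞ for all p ∈ [0,1]; (2) the buckets 𝒥 are overlapping; (3) there exists a sequential procedure (τ, I) for 𝒥 satisfying P_p(p ∉ I) ≤ ε for all p ∈ [0,1] and τ < C P_p-almost surely for all p, for some deterministic constant C > 0. -/
open MeasureTheory Set Filter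
open scoped ENNReal NNReal

noncomputable section

/-- A set of p-value buckets: a collection of subintervals of `[0,1]`, each of positive
length (i.e. containing at least two points), whose union is `[0,1]`. -/
def IsPValueBuckets (𝒥 : Set (Set ℝ)) : Prop :=
  (∀ J ∈ 𝒥, J ⊆ Set.Icc (0:ℝ) 1 ∧ J.OrdConnected ∧ ¬ J.Subsingleton) ∧
    ⋃₀ 𝒥 = Set.Icc (0:ℝ) 1

/-- The buckets `𝒥` are overlapping if every `p ∈ (0,1)` lies in the interior of some bucket. -/
def IsOverlapping (𝒥 : Set (Set ℝ)) : Prop :=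
  ∀ p ∈ Set.Ioo (0:ℝ) 1, ∃ J ∈ 𝒥, p ∈ interior J

/-- `μ` is the law on `{0,1}^ℕ` of an i.i.d. sequence of Bernoulli(`p`) random variables
(the coordinate process), characterised by the probabilities of all finite cylinder sets. -/
def IsBernoulliSeq (μ : Measure (ℕ → Bool)) (p : ℝ) : Prop :=
  IsProbabilityMeasure μ ∧
    ∀ (s : Finset ℕ) (f : ℕ → Bool),
      μ {ω | ∀ i ∈ s, ω i = f i} =
        ∏ i ∈ s, (if f i then ENNReal.ofReal p else ENNReal.ofReal (1 - p))

/-- The natural filtration of the coordinate process on `{0,1}^ℕ`: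
`coordSigma n` is the σ-algebra generated by the first `n` coordinates. -/
def coordSigma (n : ℕ) : MeasurableSpace (ℕ → Bool) :=
  MeasurableSpace.comap (fun ω (i : Fin n) => ω i) inferInstance

/-- A sequential procedure for the buckets `𝒥`: a stopping time `tau` with respect to the
natural filtration, taking values in `ℕ ∪ {∞}`, together with a `𝒥`-valued report `rep`
which is measurable with respect to the stopped σ-algebra `F_tau`. -/
structure SeqProcedure (𝒥 : Set (Set ℝ)) where
  tau : (ℕ → Bool) → ℕ∞
  rep : (ℕ → Bool) → Set ℝ
  rep_mem : ∀ ω, rep ω ∈ 𝒥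
  stopping : ∀ n : ℕ, MeasurableSet[coordSigma n] {ω | tau ω ≤ (n : ℕ∞)}
  rep_meas : ∀ B : Set (Set ℝ), MeasurableSet {ω | rep ω ∈ B}
  rep_stopped : ∀ (B : Set (Set ℝ)) (n : ℕ),
    MeasurableSet[coordSigma n] {ω | rep ω ∈ B ∧ tau ω ≤ (n : ℕ∞)}

open scoped Topology

/-- The first `n` coordinates of a binary sequence. -/
def firstCoords (n : ℕ) (ω : ℕ → Bool) : Fin n → Bool := fun i => ω i

lemma measurable_firstCoords (n : ℕ) : Measurable (firstCoords n) :=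
  measurable_pi_lambda _ fun _ => measurable_pi_apply _

lemma measurableSet_coordSigma_preimage {n : ℕ} (T : Set (Fin n → Bool)) :
    MeasurableSet[coordSigma n] (firstCoords n ⁻¹' T) :=
  ⟨T, T.toFinite.measurableSet, rfl⟩

lemma coordSigma_le (n : ℕ) : coordSigma n ≤ (inferInstance : MeasurableSpace (ℕ → Bool)) :=
  (measurable_firstCoords n).comap_le

namespace IsBernoulliSeq

variable {μ : Measure (ℕ → Bool)} {p : ℝ}

lemma measure_firstCoords_preimage (h : IsBernoulliSeq μ p) {n : ℕ} (T : Finset (Fin n → Bool)) :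
    μ (firstCoords n ⁻¹' T) =
      ∑ f ∈ T, ∏ i, (if f i then ENNReal.ofReal p else ENNReal.ofReal (1 - p)) := by
  have key (f : Fin n → Bool) : μ (firstCoords n ⁻¹' {f}) =
      ∏ i, (if f i then ENNReal.ofReal p else ENNReal.ofReal (1 - p)) := by
    let g : ℕ → Bool := fun i => if hi : i < n then f ⟨i, hi⟩ else false
    have hg (i : Fin n) : g i = f i := by simp [g]
    have hset : firstCoords n ⁻¹' {f} = {ω | ∀ i ∈ Finset.range n, ω i = g i} := by
      ext ω
      simp only [mem_preimage, mem_singleton_iff, funext_iff, firstCoords, Finset.mem_range,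
        mem_ofPred_eq]
      exact ⟨fun H i hi => by simpa [g, hi] using H ⟨i, hi⟩,
        fun H i => (H i i.2).trans (hg i)⟩
    rw [hset, h.2, Finset.prod_range]
    simp only [hg]
  rw [← sum_measure_preimage_singleton T fun f _ =>
    measurable_firstCoords n (measurableSet_singleton f)]
  exact Finset.sum_congr rfl fun f _ => key f

lemma measure_coord_eq (h : IsBernoulliSeq μ p) (i : ℕ) (b : Bool) :
    μ {ω | ω i = b} = if b then ENNReal.ofReal p else ENNReal.ofReal (1 - p) := by
  simpa using h.2 {i} fun _ => b

lemma indepFun_coord (h : IsBernoulliSeq μ p) {i j : ℕ} (hij : i ≠ j) :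
    ProbabilityTheory.IndepFun (fun ω : ℕ → Bool => ω i) (fun ω => ω j) μ := by
  have := h.1
  rw [ProbabilityTheory.indepFun_iff_map_prod_eq_prod_map_map
    (measurable_pi_apply i).aemeasurable (measurable_pi_apply j).aemeasurable]
  refine Measure.ext_of_singleton fun ⟨a, b⟩ => ?_
  rw [← singleton_prod_singleton, Measure.prod_prod,
    Measure.map_apply (measurable_pi_apply i) (measurableSet_singleton a),
    Measure.map_apply (measurable_pi_apply j) (measurableSet_singleton b),
    Measure.map_apply ((measurable_pi_apply i).prodMk (measurable_pi_apply j))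
      ((measurableSet_singleton a).prod (measurableSet_singleton b))]
  have hset : (fun ω : ℕ → Bool => (ω i, ω j)) ⁻¹' ({a} ×ˢ {b}) =
      {ω | ∀ k ∈ ({i, j} : Finset ℕ), ω k = (fun k => if k = i then a else b) k} := by
    ext ω
    simp [hij.symm]
  rw [hset, h.2, Finset.prod_pair hij]
  have hi := h.measure_coord_eq i a
  have hj := h.measure_coord_eq j b
  simp only [if_true, if_neg hij.symm, ← hi, ← hj]
  rfl

/-- Chebyshev's inequality for the empirical mean of the first `n` coordinates. -/
lemma measure_le_abs_mean_sub (h : IsBernoulliSeq μ p) (hp : p ∈ Icc (0 : ℝ) 1) {n : ℕ}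
    (hn : 0 < n) {δ : ℝ} (hδ : 0 < δ) :
    μ {ω | δ ≤ |(∑ i : Fin n, if ω i then (1 : ℝ) else 0) / n - p|} ≤
      ENNReal.ofReal (1 / (n * δ ^ 2)) := by
  have := h.1
  have hn' : (0 : ℝ) < n := by exact_mod_cast hn
  let c : Bool → ℝ := fun b => if b then 1 else 0
  have hc : Measurable c := measurable_of_finite c
  let X : Fin n → (ℕ → Bool) → ℝ := fun i ω => c (ω i)
  have hXm (i : Fin n) : Measurable (X i) := hc.comp (measurable_pi_apply _)
  have hX01 (i : Fin n) (ω : ℕ → Bool) : X i ω ∈ Icc (0 : ℝ) 1 := by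
    simp only [X, c]
    split_ifs <;> simp
  have hXL (i : Fin n) : MemLp (X i) 2 μ :=
    memLp_of_bounded (.of_forall (hX01 i)) (hXm i).aestronglyMeasurable 2
  have hXint (i : Fin n) : ∫ ω, X i ω ∂μ = p := by
    have : X i = ({ω | ω i = true} : Set (ℕ → Bool)).indicator 1 := by
      ext ω
      simp [X, c, indicator_apply]
    have hms : MeasurableSet {ω : ℕ → Bool | ω i = true} :=
      measurableSet_eq_fun (measurable_pi_apply _) measurable_const
    rw [this, integral_indicator_one hms,
      measureReal_def, h.measure_coord_eq]
    simp [hp.1]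
  have hvar (i : Fin n) : ProbabilityTheory.variance (X i) μ ≤ 1 := by
    have := ProbabilityTheory.variance_le_sub_mul_sub (μ := μ) (.of_forall (hX01 i))
      (hXm i).aemeasurable
    rw [hXint] at this
    nlinarith [hp.1, hp.2]
  have hsum : ProbabilityTheory.variance (∑ i, X i) μ ≤ n := by
    rw [ProbabilityTheory.IndepFun.variance_sum (fun i _ => hXL i)
      fun i _ j _ hij => (h.indepFun_coord (Fin.val_ne_of_ne hij)).comp hc hc]
    simpa using Finset.sum_le_sum fun i (_ : i ∈ Finset.univ) => hvar i
  have hmean : ∫ ω, (∑ i, X i) ω ∂μ = n * p := by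
    simp only [Finset.sum_apply]
    rw [integral_finsetSum _ fun i _ => (hXL i).integrable (by norm_num)]
    simp [hXint]
  have hcheb := ProbabilityTheory.meas_ge_le_variance_div_sq
    (memLp_finsetSum' Finset.univ fun i _ => hXL i) (mul_pos hn' hδ)
  rw [hmean] at hcheb
  refine (measure_mono fun ω hω => ?_).trans (hcheb.trans (ENNReal.ofReal_le_ofReal ?_))
  · have hfac : (∑ i, X i) ω - n * p =
        n * ((∑ i : Fin n, if ω i then (1 : ℝ) else 0) / n - p) := by
      rw [Finset.sum_apply]
      field_simp
      rfl
    simp only [mem_ofPred_eq] at hω ⊢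
    rw [hfac, abs_mul, abs_of_pos hn']
    gcongr
  · calc _ ≤ (n : ℝ) / (n * δ) ^ 2 := by gcongr
      _ = 1 / (n * δ ^ 2) := by field_simp

end IsBernoulliSeq

lemma continuousOn_measure_of_coordSigma {μ : ℝ → Measure (ℕ → Bool)}
    (hμ : ∀ p ∈ Icc (0 : ℝ) 1, IsBernoulliSeq (μ p) p) {n : ℕ} {A : Set (ℕ → Bool)}
    (hA : MeasurableSet[coordSigma n] A) : ContinuousOn (fun p => μ p A) (Icc 0 1) := by
  obtain ⟨T, -, rfl⟩ := hA
  have hfun : ∀ p ∈ Icc (0 : ℝ) 1, μ p (firstCoords n ⁻¹' T) = ENNReal.ofReal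
      (∑ f ∈ T.toFinite.toFinset, ∏ i, (if f i then p else 1 - p)) := by
    intro p hp
    have h := (hμ p hp).measure_firstCoords_preimage T.toFinite.toFinset
    rw [Finite.coe_toFinset] at h
    have h0 (b : Bool) : 0 ≤ if b then p else 1 - p := by
      split_ifs <;> linarith [hp.1, hp.2]
    rw [h, ENNReal.ofReal_sum_of_nonneg fun f _ => Finset.prod_nonneg fun i _ => h0 _]
    refine Finset.sum_congr rfl fun f _ => ?_
    rw [ENNReal.ofReal_prod_of_nonneg fun i _ => h0 _]
    exact Finset.prod_congr rfl fun i _ => (apply_ite _ _ _ _).symm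
  refine ContinuousOn.congr (Continuous.continuousOn ?_) hfun
  refine ENNReal.continuous_ofReal.comp (continuous_finsetSum _ fun f _ =>
    continuous_finsetProd _ fun i _ => ?_)
  split_ifs <;> fun_prop

lemma IsPValueBuckets.exists_mem_nhdsWithin {𝒥 : Set (Set ℝ)} (h𝒥 : IsPValueBuckets 𝒥)
    (hov : IsOverlapping 𝒥) {x : ℝ} (hx : x ∈ Icc (0 : ℝ) 1) :
    ∃ J ∈ 𝒥, J ∈ 𝓝[Icc 0 1] x := by
  rcases eq_or_lt_of_le hx.1 with h0 | h0
  · subst h0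
    obtain ⟨J, hJ, h0J⟩ : (0 : ℝ) ∈ ⋃₀ 𝒥 := h𝒥.2 ▸ hx
    obtain ⟨hsub, hconn, hns⟩ := h𝒥.1 J hJ
    obtain ⟨y, hy, hy0⟩ := (not_subsingleton_iff.1 hns).exists_ne 0
    have hypos : 0 < y := lt_of_le_of_ne (hsub hy).1 hy0.symm
    refine ⟨J, hJ, mem_nhdsWithin_iff_exists_mem_nhds_inter.2
      ⟨Iio y, Iio_mem_nhds hypos, fun z hz => hconn.out h0J hy ⟨hz.2.1, hz.1.le⟩⟩⟩
  rcases eq_or_lt_of_le hx.2 with h1 | h1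
  · subst h1
    obtain ⟨J, hJ, h1J⟩ : (1 : ℝ) ∈ ⋃₀ 𝒥 := h𝒥.2 ▸ hx
    obtain ⟨hsub, hconn, hns⟩ := h𝒥.1 J hJ
    obtain ⟨y, hy, hy1⟩ := (not_subsingleton_iff.1 hns).exists_ne 1
    have hylt : y < 1 := lt_of_le_of_ne (hsub hy).2 hy1
    refine ⟨J, hJ, mem_nhdsWithin_iff_exists_mem_nhds_inter.2
      ⟨Ioi y, Ioi_mem_nhds hylt, fun z hz => hconn.out hy h1J ⟨hz.1.le, hz.2.2⟩⟩⟩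
  · obtain ⟨J, hJ, hxJ⟩ := hov x ⟨h0, h1⟩
    exact ⟨J, hJ, mem_nhdsWithin_of_mem_nhds (mem_interior_iff_mem_nhds.1 hxJ)⟩

lemma IsPValueBuckets.exists_pos_ball_inter_subset {𝒥 : Set (Set ℝ)} (h𝒥 : IsPValueBuckets 𝒥)
    (hov : IsOverlapping 𝒥) :
    ∃ δ > 0, ∀ x ∈ Icc (0 : ℝ) 1, ∃ J ∈ 𝒥, Metric.ball x δ ∩ Icc 0 1 ⊆ J := by
  choose! c hc using fun x (hx : x ∈ Icc (0 : ℝ) 1) => h𝒥.exists_mem_nhdsWithin hov hx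
  obtain ⟨δ, hδ, H⟩ := Metric.uniformity_basis_dist.lebesgue_number_lemma_nhdsWithin'
    (U := fun x _ => c x) (isCompact_Icc (a := (0 : ℝ)) (b := 1)) fun x hx => (hc x hx).2
  refine ⟨δ, hδ, fun x hx => (H x hx).elim fun y hy => ⟨c y, (hc y y.2).1, ?_⟩⟩
  exact fun z hz => hy ⟨by simpa [UniformSpace.ball, dist_comm] using hz.1, hz.2⟩

/-- The procedure that samples exactly `n` times and then reports `g` of what it observed. -/
def SeqProcedure.ofFixed {𝒥 : Set (Set ℝ)} (n : ℕ) (g : (Fin n → Bool) → Set ℝ)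
    (hg : ∀ f, g f ∈ 𝒥) : SeqProcedure 𝒥 where
  tau _ := n
  rep ω := g (firstCoords n ω)
  rep_mem ω := hg _
  stopping m := MeasurableSet.const _
  rep_meas B := coordSigma_le n _ (measurableSet_coordSigma_preimage (g ⁻¹' B))
  rep_stopped B m := by
    by_cases hnm : n ≤ m
    · have hset : {ω | g (firstCoords n ω) ∈ B ∧ (n : ℕ∞) ≤ m} =
          firstCoords m ⁻¹' {f | g (fun i => f (Fin.castLE hnm i)) ∈ B} := by
        ext ω
        simp [hnm, firstCoords]
        rfl
      rw [hset]
      exact measurableSet_coordSigma_preimage _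
    · simp [hnm]

lemma exists_bounded_of_isOverlapping {𝒥 : Set (Set ℝ)} (h𝒥 : IsPValueBuckets 𝒥)
    {ε : ℝ} (hε : 0 < ε) {μ : ℝ → Measure (ℕ → Bool)}
    (hμ : ∀ p ∈ Icc (0 : ℝ) 1, IsBernoulliSeq (μ p) p) (hov : IsOverlapping 𝒥) :
    ∃ P : SeqProcedure 𝒥, ∃ C : ℕ, 0 < C ∧
      (∀ p ∈ Icc (0 : ℝ) 1, μ p {ω | p ∉ P.rep ω} ≤ ENNReal.ofReal ε) ∧
      (∀ p ∈ Icc (0 : ℝ) 1, ∀ᵐ ω ∂ (μ p), P.tau ω < (C : ℕ∞)) := by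
  obtain ⟨δ, hδ, H⟩ := h𝒥.exists_pos_ball_inter_subset hov
  choose! J hJ hJsub using H
  obtain ⟨n, hn⟩ := exists_nat_gt (1 / (ε * δ ^ 2))
  have hn' : (0 : ℝ) < n := lt_trans (by positivity) hn
  have hn0 : 0 < n := by exact_mod_cast hn'
  let m : (Fin n → Bool) → ℝ := fun f => (∑ i, if f i then (1 : ℝ) else 0) / n
  have hm (f : Fin n → Bool) : m f ∈ Icc (0 : ℝ) 1 := by
    refine ⟨div_nonneg (Finset.sum_nonneg fun i _ => by split_ifs <;> simp) hn'.le,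
      (div_le_one hn').2 ?_⟩
    calc (∑ i, if f i then (1 : ℝ) else 0) ≤ ∑ _i : Fin n, (1 : ℝ) :=
          Finset.sum_le_sum fun i _ => by split_ifs <;> simp
      _ = n := by simp
  refine ⟨.ofFixed n (fun f => J (m f)) fun f => hJ _ (hm f), n + 1, n.succ_pos,
    fun p hp => ?_, fun p _ => .of_forall fun ω => ?_⟩
  · refine (measure_mono fun ω hω => ?_).trans
      (((hμ p hp).measure_le_abs_mean_sub hp hn0 hδ).trans (ENNReal.ofReal_le_ofReal ?_))
    · by_contra hlt
      refine hω (hJsub _ (hm (firstCoords n ω)) ⟨?_, hp⟩)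
      rw [Metric.mem_ball, dist_comm, Real.dist_eq]
      exact not_le.1 hlt
    · rw [div_lt_iff₀ (by positivity)] at hn
      rw [div_le_iff₀ (by positivity)]
      nlinarith
  · exact Nat.cast_lt.2 n.lt_succ_self

lemma isOverlapping_of_ae_finite {𝒥 : Set (Set ℝ)} (h𝒥 : IsPValueBuckets 𝒥)
    {ε : ℝ} (hε : ε ∈ Ioo (0 : ℝ) (1 / 2)) {μ : ℝ → Measure (ℕ → Bool)}
    (hμ : ∀ p ∈ Icc (0 : ℝ) 1, IsBernoulliSeq (μ p) p) (P : SeqProcedure 𝒥)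
    (hrisk : ∀ p ∈ Icc (0 : ℝ) 1, μ p {ω | p ∉ P.rep ω} ≤ ENNReal.ofReal ε)
    (hfin : ∀ p ∈ Icc (0 : ℝ) 1, μ p {ω | P.tau ω = ⊤} = 0) : IsOverlapping 𝒥 := by
  intro p hp
  by_contra! hint
  have hpI : p ∈ Icc (0 : ℝ) 1 := Ioo_subset_Icc_self hp
  have hside (ω : ℕ → Bool) : Disjoint (P.rep ω) (Iio p) ∨ Disjoint (P.rep ω) (Ioi p) := by
    by_contra! hnd
    obtain ⟨x, hx, hxp⟩ := not_disjoint_iff.1 hnd.1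
    obtain ⟨y, hy, hpy⟩ := not_disjoint_iff.1 hnd.2
    refine hint _ (P.rep_mem ω) (mem_interior_iff_mem_nhds.2 ?_)
    exact mem_of_superset (Icc_mem_nhds hxp hpy) ((h𝒥.1 _ (P.rep_mem ω)).2.1.out hx hy)
  have hlim {s : Set ℝ} (hs : (𝓝[s] p).NeBot) (n : ℕ) :
      μ p {ω | P.rep ω ∈ {J | Disjoint J s} ∧ P.tau ω ≤ (n : ℕ∞)} ≤ ENNReal.ofReal ε := by
    have hs' : (𝓝[Icc 0 1 ∩ s] p).NeBot := by
      rwa [nhdsWithin_inter_of_mem (mem_nhdsWithin_of_mem_nhds (Icc_mem_nhds hp.1 hp.2))]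
    have hcont := continuousOn_measure_of_coordSigma hμ
      (P.rep_stopped {J | Disjoint J s} n) p hpI
    refine le_of_tendsto (x := 𝓝[Icc 0 1 ∩ s] p)
      (hcont.mono_left (nhdsWithin_mono p inter_subset_left)) ?_
    filter_upwards [self_mem_nhdsWithin] with q hq
    refine (measure_mono fun ω hω hqω => ?_).trans (hrisk q hq.1)
    exact disjoint_left.1 hω.1 hqω hq.2
  have hbound (n : ℕ) : μ p {ω | P.tau ω ≤ (n : ℕ∞)} ≤ ENNReal.ofReal (2 * ε) := by
    calc μ p {ω | P.tau ω ≤ (n : ℕ∞)}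
        ≤ μ p ({ω | P.rep ω ∈ {J | Disjoint J (Iio p)} ∧ P.tau ω ≤ (n : ℕ∞)} ∪
            {ω | P.rep ω ∈ {J | Disjoint J (Ioi p)} ∧ P.tau ω ≤ (n : ℕ∞)}) :=
          measure_mono fun ω hω => (hside ω).imp (⟨·, hω⟩) (⟨·, hω⟩)
      _ ≤ ENNReal.ofReal ε + ENNReal.ofReal ε :=
          (measure_union_le _ _).trans (add_le_add (hlim inferInstance n) (hlim inferInstance n))
      _ = ENNReal.ofReal (2 * ε) := by rw [← ENNReal.ofReal_add hε.1.le hε.1.le, two_mul]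
  have := (hμ p hpI).1
  have hUnion : (⋃ n : ℕ, {ω | P.tau ω ≤ (n : ℕ∞)}) ∪ {ω | P.tau ω = ⊤} = univ := by
    refine eq_univ_of_forall fun ω => ?_
    by_cases h : P.tau ω = ⊤
    · exact .inr h
    · lift P.tau ω to ℕ using h with k hk
      exact .inl (mem_iUnion.2 ⟨k, hk.ge⟩)
  have hmono : Monotone fun n : ℕ => {ω | P.tau ω ≤ (n : ℕ∞)} := fun a b hab ω hω =>
    le_trans (mem_ofPred_eq ▸ hω) (by exact_mod_cast hab)
  have htot : (1 : ℝ≥0∞) ≤ ENNReal.ofReal (2 * ε) := by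
    calc (1 : ℝ≥0∞) = μ p univ := measure_univ.symm
      _ ≤ μ p (⋃ n : ℕ, {ω | P.tau ω ≤ (n : ℕ∞)}) + μ p {ω | P.tau ω = ⊤} :=
          hUnion ▸ measure_union_le _ _
      _ = ⨆ n : ℕ, μ p {ω | P.tau ω ≤ (n : ℕ∞)} := by
          rw [hfin p hpI, add_zero, hmono.measure_iUnion]
      _ ≤ ENNReal.ofReal (2 * ε) := iSup_le hbound
  rw [ENNReal.one_le_ofReal] at htot
  linarith [hε.2]

lemma SeqProcedure.measurableSet_tau_eq_top {𝒥 : Set (Set ℝ)} (P : SeqProcedure 𝒥) :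
    MeasurableSet {ω | P.tau ω = ⊤} := by
  have hset : {ω | P.tau ω = ⊤} = ⋂ n : ℕ, {ω | P.tau ω ≤ (n : ℕ∞)}ᶜ := by
    ext ω
    simp [ENat.eq_top_iff_forall_gt]
  rw [hset]
  exact .iInter fun n => (coordSigma_le n _ (P.stopping n)).compl

lemma SeqProcedure.measure_tau_eq_top {𝒥 : Set (Set ℝ)} (P : SeqProcedure 𝒥)
    {μ : Measure (ℕ → Bool)} (h : ∫⁻ ω, (P.tau ω : ℝ≥0∞) ∂μ < ⊤) :
    μ {ω | P.tau ω = ⊤} = 0 := by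
  by_contra hne
  refine h.ne (top_le_iff.1 ?_)
  calc (⊤ : ℝ≥0∞) = ∫⁻ ω, {ω | P.tau ω = ⊤}.indicator (fun _ => ⊤) ω ∂μ := by
        rw [lintegral_indicator_const P.measurableSet_tau_eq_top, ENNReal.top_mul hne]
    _ ≤ _ := lintegral_mono (indicator_le fun ω hω => by
        rw [mem_ofPred_eq] at hω
        simp [hω])

/-- Theorem 1 of the paper: for a set of p-value buckets `𝒥` and `ε ∈ (0,1/2)`, the
existence of a sequential procedure with uniformly bounded resampling risk and finite
expected effort, the overlapping property of `𝒥`, and the existence of such a procedure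
with uniformly bounded effort, are all equivalent. -/
theorem bounded_risk_finite_effort_iff_overlapping
    (𝒥 : Set (Set ℝ)) (h𝒥 : IsPValueBuckets 𝒥)
    (ε : ℝ) (hε : ε ∈ Set.Ioo (0:ℝ) (1/2))
    (μ : ℝ → Measure (ℕ → Bool))
    (hμ : ∀ p ∈ Set.Icc (0:ℝ) 1, IsBernoulliSeq (μ p) p) :
    List.TFAE
      [ (∃ P : SeqProcedure 𝒥,
          (∀ p ∈ Set.Icc (0:ℝ) 1, μ p {ω | p ∉ P.rep ω} ≤ ENNReal.ofReal ε) ∧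
          (∀ p ∈ Set.Icc (0:ℝ) 1, ∫⁻ ω, (P.tau ω : ℝ≥0∞) ∂ (μ p) < ⊤)),
        IsOverlapping 𝒥,
        (∃ P : SeqProcedure 𝒥, ∃ C : ℕ, 0 < C ∧
          (∀ p ∈ Set.Icc (0:ℝ) 1, μ p {ω | p ∉ P.rep ω} ≤ ENNReal.ofReal ε) ∧
          (∀ p ∈ Set.Icc (0:ℝ) 1, ∀ᵐ ω ∂ (μ p), P.tau ω < (C : ℕ∞))) ] := by
  tfae_have 1 → 2 := fun ⟨P, hrisk, heff⟩ =>
    isOverlapping_of_ae_finite h𝒥 hε hμ P hrisk fun p hp => P.measure_tau_eq_top (heff p hp)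
  tfae_have 2 → 3 := exists_bounded_of_isOverlapping h𝒥 hε.1 hμ
  tfae_have 3 → 1 := by
    rintro ⟨P, C, -, hrisk, hC⟩
    refine ⟨P, hrisk, fun p hp => ?_⟩
    have := (hμ p hp).1
    calc ∫⁻ ω, (P.tau ω : ℝ≥0∞) ∂ (μ p) ≤ ∫⁻ _, (C : ℝ≥0∞) ∂ (μ p) :=
          lintegral_mono_ae ((hC p hp).mono fun ω hω => by
            simpa using ENat.toENNReal_le.2 hω.le)
      _ < ⊤ := by simp
  tfae_finish
end
end

section
/- Fix n ≥ 1, x ∈ {0, …, n} and ε ∈ (0,1), and let I = { p ∈ [0,1] : (n+1) · b(n,p,x) > ε }. Then the diameter of I is at most √( (2/n) · log((n+1)/ε) ); that is, for all p, q ∈ I, |p − q| ≤ √( (2/n) · log((n+1)/ε) ). -/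
open MeasureTheory Set Filter

noncomputable section

/-- The binomial probability mass function `b(n,p,x) = C(n,x) pˣ (1-p)ⁿ⁻ˣ`. -/
def binomPMF (n : ℕ) (p : ℝ) (x : ℕ) : ℝ :=
  (n.choose x : ℝ) * p ^ x * (1 - p) ^ (n - x)

/-- A single term of the binomial expansion is at most the whole sum. -/
theorem choose_mul_pow_mul_pow_le_add_pow {u v : ℝ} (hu : 0 ≤ u) (hv : 0 ≤ v) {n x : ℕ}
    (hx : x ≤ n) : (n.choose x : ℝ) * u ^ x * v ^ (n - x) ≤ (u + v) ^ n := by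
  rw [add_pow]
  calc (n.choose x : ℝ) * u ^ x * v ^ (n - x)
      = u ^ x * v ^ (n - x) * (n.choose x : ℝ) := by ring
    _ ≤ ∑ m ∈ Finset.range (n + 1), u ^ m * v ^ (n - m) * (n.choose m : ℝ) :=
        Finset.single_le_sum (f := fun m => u ^ m * v ^ (n - m) * (n.choose m : ℝ))
          (fun m _ => by positivity) (Finset.mem_range.2 (by omega))

/-- The squared Bhattacharyya coefficient of the Bernoulli laws with parameters `a ^ 2` and `c ^ 2`
is at most one minus the square of their total variation distance. -/
theorem sq_bhattacharyya_le {a b c d : ℝ} (hab : a ^ 2 + b ^ 2 = 1) (hcd : c ^ 2 + d ^ 2 = 1) :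
    (a * c + b * d) ^ 2 ≤ 1 - (a ^ 2 - c ^ 2) ^ 2 := by
  have hb : b ^ 2 = 1 - a ^ 2 := by linarith
  have hd : d ^ 2 = 1 - c ^ 2 := by linarith
  have key : 1 - (a ^ 2 - c ^ 2) ^ 2 - (a * c + b * d) ^ 2 = (a * b - c * d) ^ 2 := by
    ring_nf
    rw [hb, hd]
    ring
  linarith [sq_nonneg (a * b - c * d)]

theorem binomPMF_mul_binomPMF_le_exp {n x : ℕ} (hx : x ≤ n) {p q : ℝ}
    (hp : p ∈ Set.Icc (0 : ℝ) 1) (hq : q ∈ Set.Icc (0 : ℝ) 1) :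
    binomPMF n p x * binomPMF n q x ≤ Real.exp (-(n * (p - q) ^ 2)) := by
  have hp₀ := Real.sq_sqrt hp.1
  have hp₁ := Real.sq_sqrt (sub_nonneg.2 hp.2)
  have hq₀ := Real.sq_sqrt hq.1
  have hq₁ := Real.sq_sqrt (sub_nonneg.2 hq.2)
  have ha := Real.sqrt_nonneg p
  have hb := Real.sqrt_nonneg (1 - p)
  have hc := Real.sqrt_nonneg q
  have hd := Real.sqrt_nonneg (1 - q)
  generalize √p = a at *
  generalize √(1 - p) = b at *
  generalize √q = c at *
  generalize √(1 - q) = d at *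
  have hBC := sq_bhattacharyya_le (a := a) (b := b) (c := c) (d := d) (by linarith) (by linarith)
  rw [hp₀, hq₀] at hBC
  calc binomPMF n p x * binomPMF n q x
      = ((n.choose x : ℝ) * (a * c) ^ x * (b * d) ^ (n - x)) ^ 2 := by
        rw [binomPMF, binomPMF, ← hp₁, ← hq₁, ← hp₀, ← hq₀]
        ring
    _ ≤ ((a * c + b * d) ^ n) ^ 2 := by
        gcongr
        exact choose_mul_pow_mul_pow_le_add_pow (by positivity) (by positivity) hx
    _ = ((a * c + b * d) ^ 2) ^ n := pow_right_comm _ _ _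
    _ ≤ Real.exp (-(p - q) ^ 2) ^ n := by
        gcongr
        linarith [Real.add_one_le_exp (-(p - q) ^ 2)]
    _ = Real.exp (-(n * (p - q) ^ 2)) := by
        rw [← Real.exp_nat_mul]
        ring_nf

/-- Lemma 2 of the paper: the Robbins–Lai confidence set
`I = {p ∈ [0,1] : (n+1)·b(n,p,x) > ε}` has diameter at most `√((2/n)·log((n+1)/ε))`. -/
theorem robbins_lai_diameter (n x : ℕ) (hn : 1 ≤ n) (hx : x ≤ n)
    (ε : ℝ) (hε : ε ∈ Set.Ioo (0:ℝ) 1)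
    (p q : ℝ) (hp : p ∈ Set.Icc (0:ℝ) 1) (hq : q ∈ Set.Icc (0:ℝ) 1)
    (hpI : ε < ((n : ℝ) + 1) * binomPMF n p x)
    (hqI : ε < ((n : ℝ) + 1) * binomPMF n q x) :
    |p - q| ≤ Real.sqrt ((2 / n) * Real.log (((n : ℝ) + 1) / ε)) := by
  have hε₀ : 0 < ε := hε.1
  have hn₀ : (0 : ℝ) < n := by exact_mod_cast hn
  have hN : (0 : ℝ) < (n : ℝ) + 1 := by positivity
  have hprod : (ε / (n + 1)) ^ 2 < Real.exp (-(n * (p - q) ^ 2)) := by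
    refine lt_of_lt_of_le ?_ (binomPMF_mul_binomPMF_le_exp hx hp hq)
    rw [sq]
    exact mul_lt_mul'' ((div_lt_iff₀' hN).2 hpI) ((div_lt_iff₀' hN).2 hqI)
      (by positivity) (by positivity)
  have hlog := Real.log_lt_log (by positivity) hprod
  rw [Real.log_exp, Real.log_pow, ← inv_div, Real.log_inv] at hlog
  push_cast at hlog
  apply Real.abs_le_sqrt
  rw [div_mul_eq_mul_div, le_div_iff₀ hn₀]
  linarith
end
end

section
/- Fix n ≥ 1, x ∈ {0, …, n}, ε ∈ (0,1) and p ∈ [0,1]. If |p − x/n| ≥ √( log((n+1)/ε) / (2n) ), then (n+1) · b(n,p,x) ≤ ε. -/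
open MeasureTheory Set Filter

noncomputable section

/-- Hoeffding's lemma for a Bernoulli variable, in explicit form. -/
theorem one_sub_add_mul_exp_le {p : ℝ} (hp : p ∈ Set.Icc (0:ℝ) 1) (t : ℝ) :
    1 - p + p * Real.exp t ≤ Real.exp (p * t + t ^ 2 / 8) := by
  obtain ⟨hp0, hp1⟩ := hp
  have hq : 0 ≤ 1 - p := sub_nonneg.2 hp1
  let μ : Measure ℝ :=
    ENNReal.ofReal p • Measure.dirac 1 + ENNReal.ofReal (1 - p) • Measure.dirac 0
  have : IsProbabilityMeasure μ := ⟨by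
    simp [μ, ← ENNReal.ofReal_add hp0 hq]⟩
  have integral_eq (f : ℝ → ℝ) : ∫ y, f y ∂μ = p * f 1 + (1 - p) * f 0 := by
    have hf (a : ℝ) : Integrable f (Measure.dirac a) := integrable_dirac (by simp)
    rw [integral_add_measure ((hf 1).smul_measure (by simp)) ((hf 0).smul_measure (by simp))]
    simp [integral_smul_measure, hp0, hq]
  have hbound : ∀ᵐ y ∂μ, y - p ∈ Set.Icc (-p) (1 - p) := by
    refine ae_add_measure_iff.2 ⟨Measure.ae_smul_measure ?_ _, Measure.ae_smul_measure ?_ _⟩ <;>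
      simp [ae_dirac_eq]
  have hmgf := (ProbabilityTheory.hasSubgaussianMGF_of_mem_Icc_of_integral_eq_zero
    (X := fun y : ℝ => y - p) (by fun_prop) hbound (by rw [integral_eq]; ring)).mgf_le t
  rw [ProbabilityTheory.mgf, integral_eq] at hmgf
  calc 1 - p + p * Real.exp t
      = Real.exp (p * t) * (p * Real.exp (t * (1 - p)) + (1 - p) * Real.exp (t * (0 - p))) := by
        have h1 : Real.exp t = Real.exp (p * t) * Real.exp (t * (1 - p)) := by
          rw [← Real.exp_add]; ring_nf
        have h0 : 1 = Real.exp (p * t) * Real.exp (t * (0 - p)) := by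
          rw [← Real.exp_add]; simp [mul_comm]
        linear_combination p * h1 + (1 - p) * h0
    _ ≤ Real.exp (p * t) * Real.exp (t ^ 2 / 8) := by
        refine mul_le_mul_of_nonneg_left (hmgf.trans_eq ?_) (Real.exp_nonneg _)
        congr 1
        norm_num
        ring
    _ = Real.exp (p * t + t ^ 2 / 8) := (Real.exp_add _ _).symm

/-- The Chernoff bound for a single binomial probability. -/
theorem binomPMF_mul_exp_le (n x : ℕ) (hx : x ≤ n) {p : ℝ} (hp : p ∈ Set.Icc (0:ℝ) 1) (t : ℝ) :
    binomPMF n p x * Real.exp (x * t) ≤ (1 - p + p * Real.exp t) ^ n := by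
  have hq : 0 ≤ 1 - p := sub_nonneg.2 hp.2
  have hp0 := hp.1
  rw [add_comm (1 - p), add_pow, binomPMF]
  refine le_trans (le_of_eq ?_) (Finset.single_le_sum
    (f := fun k => (p * Real.exp t) ^ k * (1 - p) ^ (n - k) * (n.choose k : ℝ))
    (fun k _ => by positivity) (Finset.mem_range_succ_iff.2 hx))
  rw [Real.exp_nat_mul, mul_pow]
  ring

/-- The Hoeffding bound for a single binomial probability. -/
theorem binomPMF_le_exp (n x : ℕ) (hn : 1 ≤ n) (hx : x ≤ n) {p : ℝ} (hp : p ∈ Set.Icc (0:ℝ) 1) :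
    binomPMF n p x ≤ Real.exp (-(2 * n * (p - x / n) ^ 2)) := by
  have hn0 : (n : ℝ) ≠ 0 := by positivity
  have hq : 0 ≤ 1 - p := sub_nonneg.2 hp.2
  have hp0 := hp.1
  set t : ℝ := 4 * (x / n - p) with ht
  have hle : binomPMF n p x * Real.exp (x * t) ≤ Real.exp (n * (p * t + t ^ 2 / 8)) := by
    rw [Real.exp_nat_mul (p * t + t ^ 2 / 8) n]
    exact (binomPMF_mul_exp_le n x hx hp t).trans
      (pow_le_pow_left₀ (by positivity) (one_sub_add_mul_exp_le hp t) n)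
  rw [← le_div_iff₀ (Real.exp_pos _), ← Real.exp_sub] at hle
  refine hle.trans_eq (congrArg Real.exp ?_)
  rw [ht]
  field_simp
  ring

/-- The Hoeffding-based exclusion step: if `|p - x/n| ≥ √(log((n+1)/ε)/(2n))` then
`(n+1)·b(n,p,x) ≤ ε`. -/
theorem hoeffding_exclusion (n x : ℕ) (hn : 1 ≤ n) (hx : x ≤ n)
    (ε : ℝ) (hε : ε ∈ Set.Ioo (0:ℝ) 1)
    (p : ℝ) (hp : p ∈ Set.Icc (0:ℝ) 1)
    (h : Real.sqrt (Real.log (((n : ℝ) + 1) / ε) / (2 * n)) ≤ |p - (x : ℝ) / n|) :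
    ((n : ℝ) + 1) * binomPMF n p x ≤ ε := by
  obtain ⟨hε0, -⟩ := hε
  have hn0 : (0:ℝ) < n := by positivity
  have hlog : Real.log (((n : ℝ) + 1) / ε) ≤ 2 * n * (p - x / n) ^ 2 := by
    have hsq := (Real.sqrt_le_left (abs_nonneg _)).1 h
    rwa [sq_abs, div_le_iff₀' (by positivity)] at hsq
  calc ((n : ℝ) + 1) * binomPMF n p x
      ≤ (n + 1) * Real.exp (-Real.log (((n : ℝ) + 1) / ε)) := by
        gcongr
        exact (binomPMF_le_exp n x hn hx hp).trans (Real.exp_le_exp.2 (neg_le_neg hlog))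
    _ = ε := by
        rw [Real.exp_neg, Real.exp_log (by positivity)]
        field_simp
end
end

section
/- Let A ⊂ (0,1) be a finite set, ρ ∈ (0,1), and N ∈ ℕ ∪ {∞}. For each α ∈ A let (L_{n,α})_{n≥1} and (U_{n,α})_{n≥1} be integer sequences with L_{n,α} < U_{n,α} for all n, and on the Bernoulli(p) sequence space define σ_α = inf{ n ≥ 1 : S_n ≥ U_{n,α} or S_n ≤ L_{n,α} }, and for n ∈ ℕ set I_{n,α} = [0,1] if n < σ_α, I_{n,α} = [0,α) if n ≥ σ_α and S_{σ_α} ≤ L_{σ_α,α}, and I_{n,α} = (α,1] if n ≥ σ_α and S_{σ_α} ≥ U_{σ_α,α}; let I_n = ∩_{α∈A} I_{n,α}. Assume: (i) for all α, α' ∈ A with α < α' and all n < N, U_{n,α} ≤ U_{n,α'} and L_{n,α} ≤ L_{n,α'}; and (ii) for every α ∈ A and p ∈ [0,1]: if p ≥ α then P_p( σ_α < N and S_{σ_α} ≤ L_{σ_α,α} ) ≤ ρ, and if p ≤ α then P_p( σ_α < N and S_{σ_α} ≥ U_{σ_α,α} ) ≤ ρ. Then for all p ∈ [0,1], P_p(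 p ∈ I_n for all n < N ) ≥ 1 − 2ρ. -/
open MeasureTheory Set Filter

noncomputable section

/-- `count ω n` is the number of successes `S_n` among the first `n` samples. -/
def count (ω : ℕ → Bool) (n : ℕ) : ℕ := ∑ i ∈ Finset.range n, (if ω i then 1 else 0)

/-- The first time `n ≥ 1` at which the success count `S_n` hits the lower boundary `L`
or the upper boundary `U` (`⊤` if this never happens). -/
def hitTime (L U : ℕ → ℤ) (ω : ℕ → Bool) : ℕ∞ :=
  sInf {t : ℕ∞ | ∃ m : ℕ, t = (m : ℕ∞) ∧ 1 ≤ m ∧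
    ((U m ≤ (count ω m : ℤ)) ∨ ((count ω m : ℤ) ≤ L m))}

open Classical in
/-- The Simctest interval `I_{n,α}` for threshold `α` at time `n`: `[0,1]` before the
boundaries are hit, `[0,α)` upon hitting the lower boundary first, and `(α,1]` upon
hitting the upper boundary first. -/
def confInt (L U : ℕ → ℤ) (α : ℝ) (n : ℕ) (ω : ℕ → Bool) : Set ℝ :=
  if (n : ℕ∞) < hitTime L U ω then Set.Icc 0 1
  else if ∃ m : ℕ, hitTime L U ω = (m : ℕ∞) ∧ (count ω m : ℤ) ≤ L m then Set.Ico 0 α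
  else Set.Ioc α 1

theorem hitTime_le {L U : ℕ → ℤ} {ω : ℕ → Bool} {m : ℕ} (hm : 1 ≤ m)
    (h : U m ≤ (count ω m : ℤ) ∨ (count ω m : ℤ) ≤ L m) : hitTime L U ω ≤ m :=
  sInf_le ⟨m, rfl, hm, h⟩

theorem hitTime_spec {L U : ℕ → ℤ} {ω : ℕ → Bool} {m : ℕ} (h : hitTime L U ω = m) :
    1 ≤ m ∧ (U m ≤ (count ω m : ℤ) ∨ (count ω m : ℤ) ≤ L m) := by
  have hne : {t : ℕ∞ | ∃ m : ℕ, t = (m : ℕ∞) ∧ 1 ≤ m ∧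
      ((U m ≤ (count ω m : ℤ)) ∨ ((count ω m : ℤ) ≤ L m))}.Nonempty := by
    by_contra hne
    rw [Set.not_nonempty_iff_eq_empty] at hne
    rw [hitTime, hne, sInf_empty] at h
    exact ENat.top_ne_natCast m h
  obtain ⟨k, hk, h1, hit⟩ := csInf_mem hne
  have hkm : k = m := by
    have : (k : ℕ∞) = m := hk.symm.trans h
    exact_mod_cast this
  exact hkm ▸ ⟨h1, hit⟩

/-- The path `ω` leaves through the lower boundary, before time `N`. -/
def lowerHit (N : ℕ∞) (L U : ℕ → ℤ) : Set (ℕ → Bool) :=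
  {ω | hitTime L U ω < N ∧ ∃ m : ℕ, hitTime L U ω = (m : ℕ∞) ∧ (count ω m : ℤ) ≤ L m}

/-- The path `ω` leaves through the upper boundary, before time `N`. -/
def upperHit (N : ℕ∞) (L U : ℕ → ℤ) : Set (ℕ → Bool) :=
  {ω | hitTime L U ω < N ∧ ∃ m : ℕ, hitTime L U ω = (m : ℕ∞) ∧ U m ≤ (count ω m : ℤ)}

theorem lowerHit_subset {N : ℕ∞} {L U L' U' : ℕ → ℤ} (hLU : ∀ n, 1 ≤ n → L n < U n)
    (hmono : ∀ n : ℕ, 1 ≤ n → (n : ℕ∞) < N → U n ≤ U' n ∧ L n ≤ L' n) :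
    lowerHit N L U ⊆ lowerHit N L' U' := by
  rintro ω ⟨hN, m, hm, hc⟩
  have h1 := (hitTime_spec hm).1
  have hmN : (m : ℕ∞) < N := hm ▸ hN
  have hle : hitTime L' U' ω ≤ m := hitTime_le h1 (Or.inr (hc.trans (hmono m h1 hmN).2))
  obtain ⟨k, hk⟩ := ENat.ne_top_iff_exists.1 (ne_top_of_le_ne_top (ENat.natCast_ne_top m) hle)
  have hkm : k ≤ m := by rw [← hk] at hle; exact_mod_cast hle
  obtain ⟨hk1, hit⟩ := hitTime_spec hk.symm
  refine ⟨hle.trans_lt hmN, k, hk.symm, hit.resolve_left fun hU => ?_⟩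
  have hU' := (hmono k hk1 ((Nat.cast_le.2 hkm).trans_lt hmN)).1.trans hU
  have hmk : hitTime L U ω ≤ k := hitTime_le hk1 (Or.inl hU')
  have hmk : m ≤ k := by rw [hm] at hmk; exact_mod_cast hmk
  obtain rfl := le_antisymm hkm hmk
  exact absurd (hLU k hk1) (not_lt.2 (hU'.trans hc))

theorem upperHit_subset {N : ℕ∞} {L U L' U' : ℕ → ℤ} (hLU : ∀ n, 1 ≤ n → L n < U n)
    (hmono : ∀ n : ℕ, 1 ≤ n → (n : ℕ∞) < N → U' n ≤ U n ∧ L' n ≤ L n) :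
    upperHit N L U ⊆ upperHit N L' U' := by
  rintro ω ⟨hN, m, hm, hc⟩
  have h1 := (hitTime_spec hm).1
  have hmN : (m : ℕ∞) < N := hm ▸ hN
  have hle : hitTime L' U' ω ≤ m := hitTime_le h1 (Or.inl ((hmono m h1 hmN).1.trans hc))
  obtain ⟨k, hk⟩ := ENat.ne_top_iff_exists.1 (ne_top_of_le_ne_top (ENat.natCast_ne_top m) hle)
  have hkm : k ≤ m := by rw [← hk] at hle; exact_mod_cast hle
  obtain ⟨hk1, hit⟩ := hitTime_spec hk.symm
  refine ⟨hle.trans_lt hmN, k, hk.symm, hit.resolve_right fun hL => ?_⟩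
  have hL' := hL.trans (hmono k hk1 ((Nat.cast_le.2 hkm).trans_lt hmN)).2
  have hmk : hitTime L U ω ≤ k := hitTime_le hk1 (Or.inr hL')
  have hmk : m ≤ k := by rw [hm] at hmk; exact_mod_cast hmk
  obtain rfl := le_antisymm hkm hmk
  exact absurd (hLU k hk1) (not_lt.2 (hc.trans hL'))

theorem hit_of_notMem_confInt {N : ℕ∞} {L U : ℕ → ℤ} {α p : ℝ} {n : ℕ} {ω : ℕ → Bool}
    (hp : p ∈ Set.Icc (0:ℝ) 1) (hn : (n : ℕ∞) < N) (h : p ∉ confInt L U α n ω) :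
    (α ≤ p ∧ ω ∈ lowerHit N L U) ∨ (p ≤ α ∧ ω ∈ upperHit N L U) := by
  unfold confInt at h
  split_ifs at h with hlt hlow
  · exact absurd hp h
  · exact Or.inl ⟨le_of_not_gt fun hpα => h ⟨hp.1, hpα⟩, (not_lt.1 hlt).trans_lt hn, hlow⟩
  · have hle := not_lt.1 hlt
    obtain ⟨m, hm⟩ := ENat.ne_top_iff_exists.1 (ne_top_of_le_ne_top (ENat.natCast_ne_top n) hle)
    exact Or.inr ⟨le_of_not_gt fun hpα => h ⟨hpα, hp.2⟩, hle.trans_lt hn, m, hm.symm,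
      (hitTime_spec hm.symm).2.resolve_right fun hc => hlow ⟨m, hm.symm, hc⟩⟩

/-- A finite family of sets whose union is contained in one of its members has measure
bounded by any common bound. -/
theorem measure_biUnion_le_of_subset_mem {Ω ι : Type*} [MeasurableSpace Ω] (μ : Measure Ω)
    (s : Finset ι) (E : ι → Set Ω) (c : ENNReal) (hc : ∀ i ∈ s, μ (E i) ≤ c)
    (h : s.Nonempty → ∃ i ∈ s, ∀ j ∈ s, E j ⊆ E i) : μ (⋃ i ∈ s, E i) ≤ c := by
  rcases s.eq_empty_or_nonempty with rfl | hs
  · simp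
  · obtain ⟨i, hi, hsub⟩ := h hs
    exact (measure_mono (Set.iUnion₂_subset hsub)).trans (hc i hi)

/-- Theorem 2 of the paper: joint coverage of the Simctest-based confidence sequence for
multiple thresholds. Under the monotonicity (i) of the boundaries and the resampling-risk
guarantee (ii) for each threshold, the intersection `I_n = ∩_α I_{n,α}` contains `p` for
all `n < N` with probability at least `1 - 2ρ`. -/
theorem simctest_joint_coverage
    (A : Finset ℝ) (hA : ∀ α ∈ A, α ∈ Set.Ioo (0:ℝ) 1)
    (ρ : ℝ) (hρ : ρ ∈ Set.Ioo (0:ℝ) 1) (N : ℕ∞)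
    (L U : ℝ → ℕ → ℤ)
    (hLU : ∀ α ∈ A, ∀ n : ℕ, 1 ≤ n → L α n < U α n)
    (μ : ℝ → Measure (ℕ → Bool))
    (hμ : ∀ p ∈ Set.Icc (0:ℝ) 1, IsBernoulliSeq (μ p) p)
    (hmono : ∀ α ∈ A, ∀ α' ∈ A, α < α' → ∀ n : ℕ, 1 ≤ n → (n : ℕ∞) < N →
      U α n ≤ U α' n ∧ L α n ≤ L α' n)
    (hlow : ∀ α ∈ A, ∀ p ∈ Set.Icc (0:ℝ) 1, α ≤ p →
      μ p {ω | hitTime (L α) (U α) ω < N ∧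
        ∃ m : ℕ, hitTime (L α) (U α) ω = (m : ℕ∞) ∧ (count ω m : ℤ) ≤ L α m}
        ≤ ENNReal.ofReal ρ)
    (hup : ∀ α ∈ A, ∀ p ∈ Set.Icc (0:ℝ) 1, p ≤ α →
      μ p {ω | hitTime (L α) (U α) ω < N ∧
        ∃ m : ℕ, hitTime (L α) (U α) ω = (m : ℕ∞) ∧ U α m ≤ (count ω m : ℤ)}
        ≤ ENNReal.ofReal ρ) :
    ∀ p ∈ Set.Icc (0:ℝ) 1,
      ENNReal.ofReal (1 - 2 * ρ) ≤
        μ p {ω | ∀ n : ℕ, (n : ℕ∞) < N →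
          p ∈ ⋂ α ∈ A, confInt (L α) (U α) α n ω} := by
  intro p hp
  have := (hμ p hp).1
  have hlower : μ p (⋃ α ∈ A.filter (· ≤ p), lowerHit N (L α) (U α)) ≤ ENNReal.ofReal ρ := by
    refine measure_biUnion_le_of_subset_mem _ _ _ _ (fun α hα => ?_) fun hne => ?_
    · rw [Finset.mem_filter] at hα
      exact hlow α hα.1 p hp hα.2
    · refine ⟨_, Finset.max'_mem _ hne, fun α hα => ?_⟩
      have hmax := Finset.max'_mem _ hne
      rcases (Finset.le_max' _ α hα).eq_or_lt with heq | hlt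
      · rw [← heq]
      · exact lowerHit_subset (hLU α (Finset.mem_filter.1 hα).1)
          (hmono α (Finset.mem_filter.1 hα).1 _ (Finset.mem_filter.1 hmax).1 hlt)
  have hupper : μ p (⋃ α ∈ A.filter (p ≤ ·), upperHit N (L α) (U α)) ≤ ENNReal.ofReal ρ := by
    refine measure_biUnion_le_of_subset_mem _ _ _ _ (fun α hα => ?_) fun hne => ?_
    · rw [Finset.mem_filter] at hα
      exact hup α hα.1 p hp hα.2
    · refine ⟨_, Finset.min'_mem _ hne, fun α hα => ?_⟩
      have hmin := Finset.min'_mem _ hne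
      rcases (Finset.min'_le _ α hα).eq_or_lt with heq | hlt
      · rw [heq]
      · exact upperHit_subset (hLU α (Finset.mem_filter.1 hα).1)
          (hmono _ (Finset.mem_filter.1 hmin).1 α (Finset.mem_filter.1 hα).1 hlt)
  set good : Set (ℕ → Bool) := {ω | ∀ n : ℕ, (n : ℕ∞) < N →
    p ∈ ⋂ α ∈ A, confInt (L α) (U α) α n ω} with hgood
  have hcover : (Set.univ : Set (ℕ → Bool)) ⊆ good ∪
      ((⋃ α ∈ A.filter (· ≤ p), lowerHit N (L α) (U α)) ∪
        ⋃ α ∈ A.filter (p ≤ ·), upperHit N (L α) (U α)) := by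
    intro ω _
    by_cases hω : ω ∈ good
    · exact Or.inl hω
    · right
      simp only [hgood, Set.mem_ofPred_eq, Set.mem_iInter, not_forall] at hω
      obtain ⟨n, hn, α, hα, hmem⟩ := hω
      rcases hit_of_notMem_confInt hp hn hmem with ⟨h, hit⟩ | ⟨h, hit⟩
      · exact Or.inl (Set.mem_biUnion (Finset.mem_coe.2 (Finset.mem_filter.2 ⟨hα, h⟩)) hit)
      · exact Or.inr (Set.mem_biUnion (Finset.mem_coe.2 (Finset.mem_filter.2 ⟨hα, h⟩)) hit)
  have hρ0 : 0 ≤ ρ := hρ.1.le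
  rw [ENNReal.ofReal_sub _ (by positivity), ENNReal.ofReal_one, tsub_le_iff_right, two_mul,
    ENNReal.ofReal_add hρ0 hρ0, ← measure_univ (μ := μ p)]
  calc μ p Set.univ ≤ _ := measure_mono hcover
    _ ≤ _ := measure_union_le _ _
    _ ≤ _ := add_le_add_right (measure_union_le _ _) _
    _ ≤ _ := add_le_add_right (add_le_add hlower hupper) _
end
end

section
/- Let N ∈ ℕ ∪ {∞} and let (L_n), (U_n), (L'_n), (U'_n) be real sequences with L_n < U_n, L'_n < U'_n, L_n ≤ L'_n and U_n ≤ U'_n for all n < N. For an arbitrary real sequence (S_n)_{n≥1} define σ = inf{ n ≥ 1 : S_n ≥ U_n or S_n ≤ L_n } and σ' = inf{ n ≥ 1 : S_n ≥ U'_n or S_n ≤ L'_n }. Then: (a) if σ' < N and S_{σ'} ≥ U'_{σ'}, then σ ≤ σ' (so σ < N) and S_σ ≥ U_σ; and (b) if σ < N and S_σ ≤ L_σ, then σ' ≤ σ (so σ' < N) and S_{σ'} ≤ L'_{σ'}. -/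
open MeasureTheory Set Filter

noncomputable section

/-- The first time `n ≥ 1` at which the sequence `S` exits the corridor between the
boundaries `L` and `U` (`⊤` if this never happens). -/
def hitTimeR (L U S : ℕ → ℝ) : ℕ∞ :=
  sInf {t : ℕ∞ | ∃ m : ℕ, t = (m : ℕ∞) ∧ 1 ≤ m ∧ (U m ≤ S m ∨ S m ≤ L m)}

theorem hitTimeR_le {L U S : ℕ → ℝ} {m : ℕ} (hm : 1 ≤ m) (h : U m ≤ S m ∨ S m ≤ L m) :
    hitTimeR L U S ≤ m :=
  sInf_le ⟨m, rfl, hm, h⟩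

theorem exit_of_hitTimeR_eq {L U S : ℕ → ℝ} {m : ℕ} (h : hitTimeR L U S = m) :
    1 ≤ m ∧ (U m ≤ S m ∨ S m ≤ L m) := by
  have hne : {t : ℕ∞ | ∃ m : ℕ, t = (m : ℕ∞) ∧ 1 ≤ m ∧ (U m ≤ S m ∨ S m ≤ L m)}.Nonempty := by
    by_contra hempty
    rw [Set.not_nonempty_iff_eq_empty] at hempty
    rw [hitTimeR, hempty, sInf_empty] at h
    exact ENat.top_ne_natCast m h
  obtain ⟨k, hk, hexit⟩ := csInf_mem hne
  obtain rfl : m = k := by exact_mod_cast h.symm.trans hk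
  exact hexit

theorem hitTimeR_neg (L U S : ℕ → ℝ) : hitTimeR (-U) (-L) (-S) = hitTimeR L U S := by
  simp only [hitTimeR, Pi.neg_apply, neg_le_neg_iff, or_comm]

theorem upper_exit_of_le {N : ℕ∞} {L U L' U' S : ℕ → ℝ}
    (hb : ∀ n : ℕ, 1 ≤ n → (n : ℕ∞) < N → L' n < U' n ∧ L n ≤ L' n ∧ U n ≤ U' n)
    {m : ℕ} (hN : (m : ℕ∞) < N) (hm : hitTimeR L' U' S = m) (hU : U' m ≤ S m) :
    hitTimeR L U S ≤ hitTimeR L' U' S ∧ ∃ k : ℕ, hitTimeR L U S = k ∧ U k ≤ S k := by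
  have hm1 := (exit_of_hitTimeR_eq hm).1
  obtain ⟨hlt, -, hUU⟩ := hb m hm1 hN
  have hle : hitTimeR L U S ≤ m := hitTimeR_le hm1 (Or.inl (hUU.trans hU))
  refine ⟨hm ▸ hle, ?_⟩
  obtain ⟨k, hk⟩ := ENat.ne_top_iff_exists.1 (ne_top_of_le_ne_top (ENat.natCast_ne_top m) hle)
  obtain ⟨hk1, hexit⟩ := exit_of_hitTimeR_eq hk.symm
  have hkm : (k : ℕ∞) ≤ m := hk ▸ hle
  refine ⟨k, hk.symm, hexit.resolve_right fun hL => ?_⟩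
  have hL' := hL.trans (hb k hk1 (hkm.trans_lt hN)).2.1
  have hmk : (m : ℕ∞) ≤ k := hm ▸ hitTimeR_le hk1 (Or.inr hL')
  obtain rfl : k = m := by exact_mod_cast le_antisymm hkm hmk
  linarith

/-- Pathwise monotonicity of boundary-hitting events (display (11) of the paper): for
pointwise ordered pairs of boundaries, exiting through the upper boundary of the larger
pair forces an earlier exit through the upper boundary of the smaller pair, and exiting
through the lower boundary of the smaller pair forces an earlier exit through the lower
boundary of the larger pair. -/
theorem hitting_monotone (N : ℕ∞) (L U L' U' S : ℕ → ℝ)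
    (hb : ∀ n : ℕ, 1 ≤ n → (n : ℕ∞) < N →
      L n < U n ∧ L' n < U' n ∧ L n ≤ L' n ∧ U n ≤ U' n) :
    ((hitTimeR L' U' S < N ∧ (∃ m : ℕ, hitTimeR L' U' S = (m : ℕ∞) ∧ U' m ≤ S m)) →
      hitTimeR L U S ≤ hitTimeR L' U' S ∧
        (∃ m : ℕ, hitTimeR L U S = (m : ℕ∞) ∧ U m ≤ S m)) ∧
    ((hitTimeR L U S < N ∧ (∃ m : ℕ, hitTimeR L U S = (m : ℕ∞) ∧ S m ≤ L m)) →
      hitTimeR L' U' S ≤ hitTimeR L U S ∧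
        (∃ m : ℕ, hitTimeR L' U' S = (m : ℕ∞) ∧ S m ≤ L' m)) := by
  refine ⟨?_, ?_⟩
  · rintro ⟨hN, m, hm, hU⟩
    exact upper_exit_of_le (fun n h1 hn => (hb n h1 hn).2) (hm ▸ hN) hm hU
  · rintro ⟨hN, m, hm, hL⟩
    have hneg : ∀ n : ℕ, 1 ≤ n → (n : ℕ∞) < N →
        (-U) n < (-L) n ∧ (-U') n ≤ (-U) n ∧ (-L') n ≤ (-L) n := fun n h1 hn => by
      obtain ⟨hLU, -, hLL, hUU⟩ := hb n h1 hn
      exact ⟨neg_lt_neg hLU, neg_le_neg hUU, neg_le_neg hLL⟩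
    simpa only [hitTimeR_neg, Pi.neg_apply, neg_le_neg_iff] using
      upper_exit_of_le (S := -S) hneg (hm ▸ hN) ((hitTimeR_neg L U S).trans hm) (neg_le_neg hL)
end
end

section
/- Fix n ≥ 1, x ∈ {0, …, n}, ε ∈ (0,1) and real numbers 0 < a < b < 1. Suppose that (n+1)·b(n,a,x) ≤ ε, (n+1)·b(n,b,x) ≤ ε, x/a − (n−x)/(1−a) ≥ 0, and x/b − (n−x)/(1−b) ≤ 0. Then { p ∈ [0,1] : (n+1)·b(n,p,x) > ε } ⊆ (a,b). -/
open MeasureTheory Set Filter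

noncomputable section

/-- The tangent-line bound for the concave log-likelihood: if moving from `a` to `p` goes against
the sign of the score at `a`, then the likelihood does not increase. -/
theorem pow_mul_one_sub_pow_le_of_sub_mul_score_nonpos {p a : ℝ} (x m : ℕ) (hp0 : 0 ≤ p)
    (hp1 : p ≤ 1) (ha0 : 0 < a) (ha1 : a < 1) (h : (p - a) * (x / a - m / (1 - a)) ≤ 0) :
    p ^ x * (1 - p) ^ m ≤ a ^ x * (1 - a) ^ m := by
  have ha1' : 0 < 1 - a := sub_pos.mpr ha1
  have hp1' : 0 ≤ 1 - p := sub_nonneg.mpr hp1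
  have pow_le_exp (t : ℝ) (ht : 0 ≤ t) (k : ℕ) : t ^ k ≤ Real.exp (k * (t - 1)) := by
    rw [Real.exp_nat_mul]
    exact pow_le_pow_left₀ ht (by linarith [Real.add_one_le_exp (t - 1)]) k
  have hratio : (p / a) ^ x * ((1 - p) / (1 - a)) ^ m ≤ 1 := by
    calc (p / a) ^ x * ((1 - p) / (1 - a)) ^ m
        ≤ Real.exp (x * (p / a - 1)) * Real.exp (m * ((1 - p) / (1 - a) - 1)) := by
          gcongr
          · exact pow_le_exp _ (by positivity) x
          · exact pow_le_exp _ (by positivity) m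
      _ = Real.exp ((p - a) * (x / a - m / (1 - a))) := by
          rw [← Real.exp_add]
          congr 1
          field_simp
          ring
      _ ≤ 1 := Real.exp_le_one_iff.mpr h
  rwa [div_pow, div_pow, div_mul_div_comm, div_le_one (by positivity)] at hratio

theorem binomPMF_le_of_sub_mul_score_nonpos {n x : ℕ} {p a : ℝ} (hx : x ≤ n) (hp0 : 0 ≤ p)
    (hp1 : p ≤ 1) (ha0 : 0 < a) (ha1 : a < 1)
    (h : (p - a) * ((x : ℝ) / a - ((n : ℝ) - x) / (1 - a)) ≤ 0) :
    binomPMF n p x ≤ binomPMF n a x := by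
  rw [← Nat.cast_sub hx] at h
  simp only [binomPMF, mul_assoc]
  exact mul_le_mul_of_nonneg_left
    (pow_mul_one_sub_pow_le_of_sub_mul_score_nonpos x (n - x) hp0 hp1 ha0 ha1 h) (by positivity)

/-- The Appendix B criterion of the paper: if `(n+1)·b(n,·,x)` is below `ε` at `a` and `b`
and the log-likelihood is nondecreasing at `a` and nonincreasing at `b`, then the
Robbins–Lai confidence set is contained in `(a,b)`. -/
theorem robbins_lai_containment_criterion
    (n x : ℕ) (hn : 1 ≤ n) (hx : x ≤ n)
    (ε : ℝ) (hε : ε ∈ Set.Ioo (0:ℝ) 1)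
    (a b : ℝ) (ha : 0 < a) (hab : a < b) (hb : b < 1)
    (h1 : ((n : ℝ) + 1) * binomPMF n a x ≤ ε)
    (h2 : ((n : ℝ) + 1) * binomPMF n b x ≤ ε)
    (h3 : 0 ≤ (x : ℝ) / a - ((n : ℝ) - x) / (1 - a))
    (h4 : (x : ℝ) / b - ((n : ℝ) - x) / (1 - b) ≤ 0) :
    {p : ℝ | p ∈ Set.Icc (0:ℝ) 1 ∧ ε < ((n : ℝ) + 1) * binomPMF n p x}
      ⊆ Set.Ioo a b := by
  rintro p ⟨⟨hp0, hp1⟩, hp⟩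
  constructor
  · by_contra! hpa
    have hle := binomPMF_le_of_sub_mul_score_nonpos hx hp0 hp1 ha (hab.trans hb)
      (mul_nonpos_of_nonpos_of_nonneg (sub_nonpos.mpr hpa) h3)
    exact absurd (hp.trans_le (mul_le_mul_of_nonneg_left hle (by positivity))) h1.not_gt
  · by_contra! hbp
    have hle := binomPMF_le_of_sub_mul_score_nonpos hx hp0 hp1 (ha.trans hab) hb
      (mul_nonpos_of_nonneg_of_nonpos (sub_nonneg.mpr hbp) h4)
    exact absurd (hp.trans_le (mul_le_mul_of_nonneg_left hle (by positivity))) h2.not_gt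
end
end

section
/- For every p ∈ [0,1] and every ε ∈ (0,1), if X_1, X_2, … are i.i.d. Bernoulli(p) random variables and S_n = X_1 + ⋯ + X_n, then P_p( there exists n ∈ ℕ, n ≥ 1, such that b(n, p, S_n) ≤ ε/(n+1) ) ≤ ε. -/
open MeasureTheory Set Filter

noncomputable section

lemma count_succ (ω : ℕ → Bool) (n : ℕ) :
    count ω (n + 1) = count ω n + if ω n then 1 else 0 :=
  Finset.sum_range_succ _ n

lemma count_le (ω : ℕ → Bool) (n : ℕ) : count ω n ≤ n := by
  induction n with
  | zero => simp [count]
  | succ n ih =>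
    rw [count_succ]
    split_ifs <;> omega

lemma count_congr {ω f : ℕ → Bool} {n : ℕ} (h : ∀ i < n, ω i = f i) :
    count ω n = count f n :=
  Finset.sum_congr rfl fun i hi => by rw [h i (Finset.mem_range.1 hi)]

/-- The probability that the uniform mixture of Bernoulli laws gives to a cylinder of length `n`
with `k` successes. -/
def mixtureWeight (n k : ℕ) : ℝ := 1 / (((n : ℝ) + 1) * n.choose k)

lemma mixtureWeight_nonneg (n k : ℕ) : 0 ≤ mixtureWeight n k := by
  unfold mixtureWeight
  positivity

lemma mixtureWeight_eq_add {n k : ℕ} (hk : k ≤ n) :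
    mixtureWeight n k = mixtureWeight (n + 1) k + mixtureWeight (n + 1) (k + 1) := by
  have h₁ : ((n : ℝ) + 1) * n.choose k = (n + 1).choose (k + 1) * ((k : ℝ) + 1) := by
    exact_mod_cast Nat.add_one_mul_choose_eq n k
  have h₂ : (n.choose k : ℝ) * (n + 1) = (n + 1).choose k * ((n : ℝ) + 1 - k) := by
    have h := Nat.choose_mul_succ_eq n k
    rw [← Nat.cast_inj (R := ℝ)] at h
    push_cast [Nat.cast_sub (show k ≤ n + 1 by omega)] at h
    exact h
  have c₀ : (0 : ℝ) < n.choose k := by exact_mod_cast Nat.choose_pos hk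
  have c₁ : (0 : ℝ) < (n + 1).choose k := by exact_mod_cast Nat.choose_pos (by omega)
  have c₂ : (0 : ℝ) < (n + 1).choose (k + 1) := by exact_mod_cast Nat.choose_pos (by omega)
  have e₁ : 1 / ((n + 1).choose k : ℝ) = ((n : ℝ) + 1 - k) / (n.choose k * (n + 1)) := by
    rw [div_eq_div_iff c₁.ne' (by positivity)]
    linarith
  have e₂ : 1 / ((n + 1).choose (k + 1) : ℝ) = ((k : ℝ) + 1) / (n.choose k * (n + 1)) := by
    rw [div_eq_div_iff c₂.ne' (by positivity)]
    linarith
  unfold mixtureWeight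
  push_cast
  rw [← one_div_mul_one_div ((n : ℝ) + 1 + 1), ← one_div_mul_one_div ((n : ℝ) + 1 + 1), e₁, e₂]
  field_simp
  ring

lemma IsBernoulliSeq.measure_cylinder {μ : Measure (ℕ → Bool)} {p : ℝ}
    (hμ : IsBernoulliSeq μ p) (hp : p ∈ Set.Icc (0 : ℝ) 1) (f : ℕ → Bool) (n : ℕ) :
    μ {ω | ∀ i < n, ω i = f i} =
      ENNReal.ofReal (p ^ count f n * (1 - p) ^ (n - count f n)) := by
  have h := hμ.2 (Finset.range n) f
  simp only [Finset.mem_range] at h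
  rw [h]
  clear h
  have hq : 0 ≤ 1 - p := sub_nonneg.2 hp.2
  induction n with
  | zero => simp [count]
  | succ n ih =>
    rw [Finset.prod_range_succ, ih, count_succ]
    have hc := count_le f n
    have hnn : 0 ≤ p ^ count f n * (1 - p) ^ (n - count f n) :=
      mul_nonneg (pow_nonneg hp.1 _) (pow_nonneg hq _)
    split_ifs
    · rw [← ENNReal.ofReal_mul hnn, Nat.add_sub_add_right, pow_succ]
      ring_nf
    · rw [← ENNReal.ofReal_mul hnn, add_zero, Nat.sub_add_comm hc, pow_succ, mul_assoc]

lemma IsBernoulliSeq.measure_cylinder_le {μ : Measure (ℕ → Bool)} {p ε : ℝ}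
    (hμ : IsBernoulliSeq μ p) (hp : p ∈ Set.Icc (0 : ℝ) 1) {n : ℕ} {f : ℕ → Bool}
    (hbad : binomPMF n p (count f n) ≤ ε / ((n : ℝ) + 1)) :
    μ {ω | ∀ i < n, ω i = f i} ≤ ENNReal.ofReal (ε * mixtureWeight n (count f n)) := by
  rw [hμ.measure_cylinder hp]
  refine ENNReal.ofReal_le_ofReal ?_
  have c₀ : (0 : ℝ) < n.choose (count f n) := by
    exact_mod_cast Nat.choose_pos (count_le f n)
  rw [binomPMF, mul_assoc] at hbad
  rw [mixtureWeight, mul_one_div, ← div_div, le_div_iff₀ c₀]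
  linarith

/-- Robbins' bound restricted to a cylinder and to a finite range of times. -/
lemma IsBernoulliSeq.measure_cylinder_inter_le {μ : Measure (ℕ → Bool)} {p ε : ℝ}
    (hμ : IsBernoulliSeq μ p) (hp : p ∈ Set.Icc (0 : ℝ) 1) (hε : 0 ≤ ε) (d n : ℕ)
    (f : ℕ → Bool) :
    μ {ω | (∀ i < n, ω i = f i) ∧
        ∃ m, n ≤ m ∧ m ≤ n + d ∧ binomPMF m p (count ω m) ≤ ε / ((m : ℝ) + 1)} ≤
      ENNReal.ofReal (ε * mixtureWeight n (count f n)) := by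
  induction d generalizing n f with
  | zero =>
    by_cases hbad : binomPMF n p (count f n) ≤ ε / ((n : ℝ) + 1)
    · exact (measure_mono fun ω hω => hω.1).trans (hμ.measure_cylinder_le hp hbad)
    · refine (measure_mono (t := ∅) ?_).trans (by simp)
      rintro ω ⟨hω, m, hm₁, hm₂, hm⟩
      obtain rfl : m = n := by omega
      rw [count_congr hω] at hm
      exact hbad hm
  | succ d ih =>
    by_cases hbad : binomPMF n p (count f n) ≤ ε / ((n : ℝ) + 1)
    · exact (measure_mono fun ω hω => hω.1).trans (hμ.measure_cylinder_le hp hbad)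
    have hcount (b : Bool) :
        count (Function.update f n b) (n + 1) = count f n + if b then 1 else 0 := by
      rw [count_succ, Function.update_self,
        count_congr fun i hi => Function.update_of_ne hi.ne b f]
    have hF := ih (n + 1) (Function.update f n false)
    have hT := ih (n + 1) (Function.update f n true)
    rw [hcount] at hF hT
    rw [mixtureWeight_eq_add (count_le f n), mul_add,
      ENNReal.ofReal_add (mul_nonneg hε (mixtureWeight_nonneg _ _))
        (mul_nonneg hε (mixtureWeight_nonneg _ _))]
    refine (measure_mono ?_).trans ((measure_union_le _ _).trans (add_le_add hF hT))
    rintro ω ⟨hω, m, hm₁, hm₂, hm⟩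
    have hne : m ≠ n := by
      rintro rfl
      rw [count_congr hω] at hm
      exact hbad hm
    have hext : ∀ i < n + 1, ω i = Function.update f n (ω n) i := by
      intro i hi
      rcases Nat.lt_succ_iff_lt_or_eq.1 hi with h | rfl
      · rw [Function.update_of_ne h.ne, hω i h]
      · rw [Function.update_self]
    have hex : ∃ m, n + 1 ≤ m ∧ m ≤ n + 1 + d ∧
        binomPMF m p (count ω m) ≤ ε / ((m : ℝ) + 1) := ⟨m, by omega, by omega, hm⟩
    cases hb : ω n <;> rw [hb] at hext
    · exact Or.inl ⟨hext, hex⟩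
    · exact Or.inr ⟨hext, hex⟩

/-- Robbins' (1970) martingale inequality, equation (6) of the paper: for i.i.d.
Bernoulli(`p`) samples, `P_p(∃ n ≥ 1, b(n,p,S_n) ≤ ε/(n+1)) ≤ ε`. -/
theorem robbins_inequality
    (p ε : ℝ) (hp : p ∈ Set.Icc (0:ℝ) 1) (hε : ε ∈ Set.Ioo (0:ℝ) 1)
    (μ : Measure (ℕ → Bool)) (hμ : IsBernoulliSeq μ p) :
    μ {ω | ∃ n : ℕ, 1 ≤ n ∧ binomPMF n p (count ω n) ≤ ε / ((n : ℝ) + 1)}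
      ≤ ENNReal.ofReal ε := by
  have hmono : Monotone fun N : ℕ => {ω : ℕ → Bool |
      ∃ n ≤ N, binomPMF n p (count ω n) ≤ ε / ((n : ℝ) + 1)} :=
    fun _ _ hNM _ ⟨n, hn, h⟩ => ⟨n, hn.trans hNM, h⟩
  refine (measure_mono (t := ⋃ N : ℕ, {ω : ℕ → Bool |
      ∃ n ≤ N, binomPMF n p (count ω n) ≤ ε / ((n : ℝ) + 1)}) ?_).trans ?_
  · rintro ω ⟨n, -, h⟩
    exact mem_iUnion.2 ⟨n, n, le_rfl, h⟩
  · rw [hmono.measure_iUnion]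
    refine iSup_le fun N => ?_
    simpa [mixtureWeight, count] using
      hμ.measure_cylinder_inter_le hp hε.1.le N 0 fun _ => false
end
end
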